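/- If G is a finite simple graph and e is an edge of G, then γ_gr^L(G) − 1 ≤ γ_gr^L(G − e) ≤ γ_gr^L(G) + 2, where G − e denotes the graph obtained from G by deleting the edge e. -/

import Mathlib

/-- A list of distinct vertices `s = (v_1, …, v_k)` is an *L-sequence* of `G` if for each `i`,
`N[v_i] \ ⋃_{j<i} N(v_j) ≠ ∅`, i.e. there is a vertex `w` in the closed neighborhood of `v_i`
that lies in no open neighborhood `N(v_j)` for `j < i`. -/
def IsLSeq {V : Type*} (G : SimpleGraph V) (s : List V) : Prop :=
  s.Nodup ∧ ∀ i : Fin s.length, ∃ w : V,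
    (w = s.get i ∨ G.Adj (s.get i) w) ∧
    ∀ j : Fin s.length, j < i → ¬ G.Adj (s.get j) w

/-- The L-Grundy domination number of `G`: the maximum length of an L-sequence of `G`. -/
noncomputable def LGrundy {V : Type*} [Fintype V] (G : SimpleGraph V) : ℕ :=
  sSup {k : ℕ | ∃ s : List V, IsLSeq G s ∧ s.length = k}

/-- `w` assigns to each entry `x` of `s` a vertex of the closed neighborhood of `x` that lies in
no open neighborhood of an earlier entry. -/
def IsFootprint {V : Type*} (G : SimpleGraph V) (s : List V) (w : V → V) : Prop :=
  (∀ x ∈ s, w x = x ∨ G.Adj x (w x)) ∧ s.Pairwise fun y x => ¬ G.Adj y (w x)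

theorem isLSeq_iff_exists_isFootprint {V : Type*} {G : SimpleGraph V} {s : List V} :
    IsLSeq G s ↔ s.Nodup ∧ ∃ w : V → V, IsFootprint G s w := by
  classical
  refine and_congr_right fun hs => ⟨fun h => ?_, ?_⟩
  · choose f hf hf' using h
    have hinj := List.nodup_iff_injective_get.1 hs
    refine ⟨fun x => if hx : ∃ i, s.get i = x then f hx.choose else x, fun x hx => ?_, ?_⟩
    · have hx' : ∃ i, s.get i = x := List.mem_iff_get.1 hx
      have hc := hf hx'.choose
      rw [hx'.choose_spec] at hc
      simpa only [dif_pos hx'] using hc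
    · refine List.pairwise_iff_get.2 fun j i hji => ?_
      have hx' : ∃ k, s.get k = s.get i := ⟨i, rfl⟩
      have hi : hx'.choose = i := hinj hx'.choose_spec
      simp only [dif_pos hx', hi]
      exact hf' i j hji
  · rintro ⟨w, hw, hw'⟩ i
    exact ⟨w (s.get i), hw _ (List.get_mem s i), fun j hj => List.pairwise_iff_get.1 hw' j i hj⟩

theorem IsLSeq.length_le_LGrundy {V : Type*} [Fintype V] {G : SimpleGraph V} {s : List V}
    (hs : IsLSeq G s) : s.length ≤ LGrundy G := by
  refine le_csSup ⟨Fintype.card V, ?_⟩ ⟨s, hs, rfl⟩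
  rintro _ ⟨t, ht, rfl⟩
  exact ht.1.length_le_card

theorem exists_isLSeq_length_eq_LGrundy {V : Type*} [Fintype V] (G : SimpleGraph V) :
    ∃ s : List V, IsLSeq G s ∧ s.length = LGrundy G := by
  refine Nat.sSup_mem (s := {k : ℕ | ∃ s : List V, IsLSeq G s ∧ s.length = k})
    ⟨0, [], ⟨List.nodup_nil, fun i => i.elim0⟩, rfl⟩ ⟨Fintype.card V, ?_⟩
  rintro _ ⟨t, ht, rfl⟩
  exact ht.1.length_le_card

/-- A footprint function that does not use the edge `uv` at `u` survives the deletion of `uv`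
once `v` is dropped from the sequence. -/
theorem IsFootprint.erase_deleteEdges {V : Type*} [DecidableEq V] {G : SimpleGraph V}
    {s : List V} {w : V → V} {u v : V} (h : IsFootprint G s w) (hs : s.Nodup)
    (hu : u ∈ s → w u ≠ v) : IsFootprint (G.deleteEdges {s(u, v)}) (s.erase v) w := by
  refine ⟨fun x hx => ?_, ?_⟩
  · obtain ⟨hxv, hxs⟩ := (hs.mem_erase_iff).1 hx
    refine (h.1 x hxs).imp_right fun hadj => SimpleGraph.deleteEdges_adj.2 ⟨hadj, ?_⟩
    rw [Set.mem_singleton_iff, Sym2.eq_iff]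
    rintro (⟨rfl, hw⟩ | ⟨hw, -⟩)
    · exact hu hxs hw
    · exact hxv hw
  · exact (h.2.sublist List.erase_sublist).imp fun hn ha =>
      hn (SimpleGraph.deleteEdges_adj.1 ha).1

/-- If `u` precedes `v` and `v` is footprinted at `u`, then `u` can be footprinted at itself. -/
theorem IsFootprint.update_self {V : Type*} [DecidableEq V] {G : SimpleGraph V}
    {l r : List V} {w : V → V} {u v : V} (h : IsFootprint G (l ++ u :: r) w)
    (hs : (l ++ u :: r).Nodup) (hv : v ∈ r) (hw : w v = u) :
    IsFootprint G (l ++ u :: r) (Function.update w u u) := by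
  refine ⟨fun x hx => ?_, ?_⟩
  · by_cases hxu : x = u
    · subst hxu
      simp
    · simpa [Function.update_of_ne hxu] using h.1 x hx
  · refine List.Pairwise.imp_of_mem (R := fun y x => ¬ G.Adj y (w x) ∧ (x = u → y ∈ l)) ?_ ?_
    · intro y x _ _ hyx
      by_cases hxu : x = u
      · subst hxu
        have := (List.pairwise_append.1 h.2).2.2 y (hyx.2 rfl) v (List.mem_cons_of_mem _ hv)
        simpa [hw] using this
      · simpa [Function.update_of_ne hxu] using hyx.1
    · refine h.2.and ?_
      have hu : u ∉ l ∧ u ∉ r := by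
        have := List.nodup_middle.1 hs
        simpa using (List.nodup_cons.1 this).1
      rw [List.pairwise_append, List.pairwise_cons]
      refine ⟨?_, ⟨?_, ?_⟩, fun a ha _ _ _ => ha⟩
      · exact List.pairwise_of_forall_mem_list fun a ha _ _ _ => ha
      · rintro a ha rfl
        exact absurd ha hu.2
      · refine List.pairwise_of_forall_mem_list fun a _ b hb hbu => ?_
        exact absurd (hbu ▸ hb) hu.2

theorem IsFootprint.exists_isLSeq_deleteEdges_of_append {V : Type*} {G : SimpleGraph V}
    {l r : List V} {w : V → V} {u v : V} (h : IsFootprint G (l ++ u :: r) w)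
    (hs : (l ++ u :: r).Nodup) (huv : u ≠ v) (hv : v ∈ r) (hw : w v = u) :
    ∃ t : List V, IsLSeq (G.deleteEdges {s(u, v)}) t ∧ (l ++ u :: r).length ≤ t.length + 1 := by
  classical
  refine ⟨(l ++ u :: r).erase v, isLSeq_iff_exists_isFootprint.2 ⟨hs.erase v, _,
    (h.update_self hs hv hw).erase_deleteEdges hs fun _ => by simpa using huv⟩, ?_⟩
  have := List.le_length_erase (a := v) (l := l ++ u :: r)
  omega

/-- Deleting an edge costs an L-sequence at most one vertex. -/
theorem IsLSeq.exists_deleteEdges {V : Type*} {G : SimpleGraph V} {s : List V}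
    (h : IsLSeq G s) {u v : V} (huv : u ≠ v) :
    ∃ t : List V, IsLSeq (G.deleteEdges {s(u, v)}) t ∧ s.length ≤ t.length + 1 := by
  classical
  obtain ⟨hs, w, hw⟩ := isLSeq_iff_exists_isFootprint.1 h
  by_cases hu : u ∈ s ∧ w u = v
  swap
  · refine ⟨s.erase v, isLSeq_iff_exists_isFootprint.2 ⟨hs.erase v, w,
      hw.erase_deleteEdges hs fun hus hwu => hu ⟨hus, hwu⟩⟩, ?_⟩
    have := List.le_length_erase (a := v) (l := s)
    omega
  by_cases hv : v ∈ s ∧ w v = u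
  swap
  · rw [Sym2.eq_swap]
    refine ⟨s.erase u, isLSeq_iff_exists_isFootprint.2 ⟨hs.erase u, w,
      hw.erase_deleteEdges hs fun hvs hwv => hv ⟨hvs, hwv⟩⟩, ?_⟩
    have := List.le_length_erase (a := u) (l := s)
    omega
  obtain ⟨l, r, rfl⟩ := List.append_of_mem hu.1
  have hmem : v ∈ l ∨ v ∈ r := by simpa [huv.symm] using hv.1
  rcases hmem with hl | hr
  · obtain ⟨l₁, l₂, rfl⟩ := List.append_of_mem hl
    rw [Sym2.eq_swap]
    rw [List.append_assoc, List.cons_append] at hw hs ⊢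
    exact hw.exists_isLSeq_deleteEdges_of_append hs huv.symm (by simp) hu.2
  · exact hw.exists_isLSeq_deleteEdges_of_append hs huv hr hv.2

/-- Dropping both endpoints of a deleted edge gives back an L-sequence of the original graph. -/
theorem IsLSeq.erase_erase_of_deleteEdges {V : Type*} [DecidableEq V] {G : SimpleGraph V}
    {s : List V} {u v : V} (h : IsLSeq (G.deleteEdges {s(u, v)}) s) :
    IsLSeq G ((s.erase u).erase v) := by
  obtain ⟨hs, w, hw⟩ := isLSeq_iff_exists_isFootprint.1 h
  refine isLSeq_iff_exists_isFootprint.2 ⟨(hs.erase u).erase v, w, fun x hx => ?_, ?_⟩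
  · exact (hw.1 x (List.mem_of_mem_erase (List.mem_of_mem_erase hx))).imp_right fun ha =>
      (SimpleGraph.deleteEdges_adj.1 ha).1
  · refine (hw.2.sublist (List.erase_sublist.trans List.erase_sublist)).imp_of_mem
      fun {y x} hy _ hn ha => hn (SimpleGraph.deleteEdges_adj.2 ⟨ha, ?_⟩)
    obtain ⟨hyv, hy⟩ := ((hs.erase u).mem_erase_iff).1 hy
    obtain ⟨hyu, -⟩ := (hs.mem_erase_iff).1 hy
    rw [Set.mem_singleton_iff, Sym2.eq_iff]
    rintro (⟨hy, -⟩ | ⟨hy, -⟩)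
    · exact hyu hy
    · exact hyv hy

/-- If `e` is an edge of `G`, then
`γ_gr^L(G) − 1 ≤ γ_gr^L(G − e) ≤ γ_gr^L(G) + 2`. -/
theorem lgrundy_deleteEdge {V : Type*} [Fintype V]
    (G : SimpleGraph V) (e : Sym2 V) (he : e ∈ G.edgeSet) :
    LGrundy G - 1 ≤ LGrundy (G.deleteEdges {e}) ∧
      LGrundy (G.deleteEdges {e}) ≤ LGrundy G + 2 := by
  classical
  induction e using Sym2.ind with
  | _ u v =>
    have huv : u ≠ v := SimpleGraph.Adj.ne he
    constructor
    · obtain ⟨s, hs, hlen⟩ := exists_isLSeq_length_eq_LGrundy G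
      obtain ⟨t, ht, hst⟩ := hs.exists_deleteEdges huv
      have := ht.length_le_LGrundy
      omega
    · obtain ⟨s, hs, hlen⟩ := exists_isLSeq_length_eq_LGrundy (G.deleteEdges {s(u, v)})
      have hle := hs.erase_erase_of_deleteEdges.length_le_LGrundy
      have h₁ := List.le_length_erase (a := u) (l := s)
      have h₂ := List.le_length_erase (a := v) (l := s.erase u)
      omega
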